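/- arXiv:2003.00336 — 3 statements merged into one kernel-verified Lean document; each statement's English description precedes it below -/
import Mathlib

section
/- If the 3CNF formula φ has a satisfying assignment σ, then the constructed 3DM instance (W, X, Y, M) admits a perfect matching; explicitly, the set M' consisting of the truth-setting triples (c_k[i], a_k[i], b_k[i]) for all 1 ≤ k ≤ m_i whenever σ(x_i) is true, the truth-setting triples (c'_k[i], a_{k+1}[i], b_k[i]) for all 1 ≤ k ≤ m_i whenever σ(x_i) is false, for each clause C_j the satisfaction triple of one chosen literal of C_j made true by σ, and for each clause C_j garbage-collection triples covering tf_1[j], tf'_1[j], tf_2[j], tf'_2[j] using the two remaining uncovered c/c' nodes of the other two literal occurrences of C_j, is a perfect matching. -/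
/-!
The 3SAT → 3DM reduction (linear size).

A 3CNF formula with `n` variables and `m` clauses is a function
`φ : Fin m → Fin 3 → Fin n × Bool`, sending a clause index and a slot to a
literal `(variable, polarity)` (`true` = positive occurrence).

For each variable `i`, `mocc i` is the number of occurrences of `i` among all
clauses, and `e i` enumerates these occurrences (so in particular
`∑ i, mocc i = 3 * m`); `hpos` says every variable occurs at least once.

Vertices:
* `W` consists of the nodes `c_k[i]` (encoded `(⟨i,k⟩, true)`) and `c'_k[i]`
  (encoded `(⟨i,k⟩, false)`);
* `X` consists of the `a_k[i]` (left summand) and `t[j] = (j,0)`,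
  `tf_1[j] = (j,1)`, `tf_2[j] = (j,2)` (right summand);
* `Y` consists of the `b_k[i]` (left summand) and `t'[j] = (j,0)`,
  `tf'_1[j] = (j,1)`, `tf'_2[j] = (j,2)` (right summand).
-/

/-- A literal: a variable together with a polarity (`true` = positive). -/
abbrev Lit (n : ℕ) : Type := Fin n × Bool

/-- `σ` satisfies the 3CNF formula `φ` iff every clause contains a literal whose
variable is assigned its polarity. -/
def Satisfies {n m : ℕ} (φ : Fin m → Fin 3 → Lit n) (σ : Fin n → Bool) : Prop :=
  ∀ j : Fin m, ∃ s : Fin 3, σ (φ j s).1 = (φ j s).2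

/-- The occurrences of variable `i` in `φ`: pairs (clause, slot) whose literal
has variable `i`. -/
def Occ {n m : ℕ} (φ : Fin m → Fin 3 → Lit n) (i : Fin n) : Type :=
  {p : Fin m × Fin 3 // (φ p.1 p.2).1 = i}

/-- The set `W`: nodes `c_k[i]` (flag `true`) and `c'_k[i]` (flag `false`). -/
abbrev Wt {n : ℕ} (mocc : Fin n → ℕ) : Type := (Σ i : Fin n, Fin (mocc i)) × Bool

/-- The set `X`: nodes `a_k[i]`, plus `t[j] = (j,0)`, `tf_1[j] = (j,1)`, `tf_2[j] = (j,2)`. -/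
abbrev Xt {n : ℕ} (mocc : Fin n → ℕ) (m : ℕ) : Type :=
  (Σ i : Fin n, Fin (mocc i)) ⊕ (Fin m × Fin 3)

/-- The set `Y`: nodes `b_k[i]`, plus `t'[j] = (j,0)`, `tf'_1[j] = (j,1)`, `tf'_2[j] = (j,2)`. -/
abbrev Yt {n : ℕ} (mocc : Fin n → ℕ) (m : ℕ) : Type :=
  (Σ i : Fin n, Fin (mocc i)) ⊕ (Fin m × Fin 3)

/-- `k + 1` taken modulo `mocc i` (cyclic index arithmetic in the gadget). -/
def nextIdx {n : ℕ} {mocc : Fin n → ℕ} (hpos : ∀ i, 0 < mocc i) {i : Fin n}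
    (k : Fin (mocc i)) : Fin (mocc i) :=
  ⟨(k.1 + 1) % mocc i, Nat.mod_lt _ (hpos i)⟩

variable {n m : ℕ}

/-- The index of the occurrence `(j, s)` among the occurrences of its variable,
via the enumeration `e`. -/
def occIdx (φ : Fin m → Fin 3 → Lit n) {mocc : Fin n → ℕ}
    (e : ∀ i, Fin (mocc i) ≃ Occ φ i) (j : Fin m) (s : Fin 3) :
    Fin (mocc (φ j s).1) :=
  (e (φ j s).1).symm ⟨(j, s), rfl⟩

/-- Truth-setting triple `(c_k[i], a_k[i], b_k[i])` ("variable `i` true"). -/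
def trueTriple {n : ℕ} (mocc : Fin n → ℕ) (m : ℕ) (i : Fin n) (k : Fin (mocc i)) :
    Wt mocc × Xt mocc m × Yt mocc m :=
  ((⟨i, k⟩, true), Sum.inl ⟨i, k⟩, Sum.inl ⟨i, k⟩)

/-- Truth-setting triple `(c'_k[i], a_{k+1}[i], b_k[i])` ("variable `i` false"). -/
def falseTriple {n : ℕ} {mocc : Fin n → ℕ} (hpos : ∀ i, 0 < mocc i) (m : ℕ)
    (i : Fin n) (k : Fin (mocc i)) :
    Wt mocc × Xt mocc m × Yt mocc m :=
  ((⟨i, k⟩, false), Sum.inl ⟨i, nextIdx hpos k⟩, Sum.inl ⟨i, k⟩)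

/-- Satisfaction triple for the occurrence in clause `j`, slot `s`:
`(c'_k[i], t[j], t'[j])` if the occurrence is positive, `(c_k[i], t[j], t'[j])`
if it is negated (where `k` is the index of this occurrence). -/
def satTriple (φ : Fin m → Fin 3 → Lit n) {mocc : Fin n → ℕ}
    (e : ∀ i, Fin (mocc i) ≃ Occ φ i) (j : Fin m) (s : Fin 3) :
    Wt mocc × Xt mocc m × Yt mocc m :=
  ((⟨(φ j s).1, occIdx φ e j s⟩, !(φ j s).2), Sum.inr (j, 0), Sum.inr (j, 0))

/-- Garbage-collection triple `(c_k[i], tf_r[j], tf'_r[j])` (for `b = true`) or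
`(c'_k[i], tf_r[j], tf'_r[j])` (for `b = false`), `r ∈ {1, 2}`. -/
def garbTriple (φ : Fin m → Fin 3 → Lit n) {mocc : Fin n → ℕ}
    (e : ∀ i, Fin (mocc i) ≃ Occ φ i) (j : Fin m) (s : Fin 3) (b : Bool) (r : Fin 3) :
    Wt mocc × Xt mocc m × Yt mocc m :=
  ((⟨(φ j s).1, occIdx φ e j s⟩, b), Sum.inr (j, r), Sum.inr (j, r))

/-- The match set `M` of the constructed 3DM instance. -/
def Matches (φ : Fin m → Fin 3 → Lit n) (mocc : Fin n → ℕ)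
    (hpos : ∀ i, 0 < mocc i) (e : ∀ i, Fin (mocc i) ≃ Occ φ i) :
    Set (Wt mocc × Xt mocc m × Yt mocc m) :=
  {t | ∃ i k, t = trueTriple mocc m i k}
    ∪ {t | ∃ i k, t = falseTriple hpos m i k}
    ∪ {t | ∃ j s, t = satTriple φ e j s}
    ∪ {t | ∃ j, ∃ s, ∃ b : Bool, ∃ r : Fin 3, r ≠ 0 ∧ t = garbTriple φ e j s b r}

/-- `M'` is a perfect matching of the 3DM instance with match set `M`:
`M' ⊆ M` and every element of `W`, of `X`, and of `Y` appears in exactly one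
triple of `M'`. -/
def IsPerfectMatching {α β γ : Type*} (M M' : Set (α × β × γ)) : Prop :=
  M' ⊆ M ∧ (∀ w : α, ∃! t, t ∈ M' ∧ t.1 = w)
    ∧ (∀ x : β, ∃! t, t ∈ M' ∧ t.2.1 = x)
    ∧ (∀ y : γ, ∃! t, t ∈ M' ∧ t.2.2 = y)

theorem existsUnique_mem_range {ι τ δ : Type*} {f : ι → τ} {p : τ → δ}
    (h : Function.Bijective fun x => p (f x)) (d : δ) : ∃! t, t ∈ Set.range f ∧ p t = d := by
  obtain ⟨x, hx⟩ := h.2 d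
  refine ⟨f x, ⟨⟨x, rfl⟩, hx⟩, ?_⟩
  rintro _ ⟨⟨y, rfl⟩, hy⟩
  exact congrArg f (h.1 (hy.trans hx.symm))

theorem isPerfectMatching_range {ι α β γ : Type*} {M : Set (α × β × γ)} {f : ι → α × β × γ}
    (hM : ∀ x, f x ∈ M) (h₁ : Function.Bijective fun x => (f x).1)
    (h₂ : Function.Bijective fun x => (f x).2.1) (h₃ : Function.Bijective fun x => (f x).2.2) :
    IsPerfectMatching M (Set.range f) :=
  ⟨Set.range_subset_iff.2 hM,
    existsUnique_mem_range (p := fun t : α × β × γ => t.1) h₁,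
    existsUnique_mem_range (p := fun t : α × β × γ => t.2.1) h₂,
    existsUnique_mem_range (p := fun t : α × β × γ => t.2.2) h₃⟩

theorem nextIdx_bijective {n : ℕ} {mocc : Fin n → ℕ} (hpos : ∀ i, 0 < mocc i) (i : Fin n) :
    Function.Bijective (nextIdx hpos : Fin (mocc i) → Fin (mocc i)) := by
  refine Finite.injective_iff_bijective.1 fun k l hkl => Fin.ext ?_
  have h : k.1 + 1 ≡ l.1 + 1 [MOD mocc i] := congrArg Fin.val hkl
  exact (Nat.ModEq.add_right_cancel' 1 h).eq_of_lt_of_lt k.2 l.2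

theorem occNode_bijective {n m : ℕ} (φ : Fin m → Fin 3 → Lit n) {mocc : Fin n → ℕ}
    (e : ∀ i, Fin (mocc i) ≃ Occ φ i) :
    Function.Bijective fun q : Fin m × Fin 3 =>
      (⟨(φ q.1 q.2).1, occIdx φ e q.1 q.2⟩ : Σ i, Fin (mocc i)) := by
  constructor
  · refine Function.LeftInverse.injective (g := fun p => (e p.1 p.2).1) fun q => ?_
    exact congrArg Subtype.val (Equiv.apply_symm_apply _ _)
  · rintro ⟨i, k⟩
    obtain ⟨⟨q, rfl⟩, hq⟩ : ∃ o, e i k = o := ⟨_, rfl⟩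
    refine ⟨q, ?_⟩
    simp only [occIdx, Sigma.mk.injEq, heq_eq_eq, true_and]
    exact (Equiv.symm_apply_eq _).2 hq.symm

/-- The triples of the explicit matching, indexed by the truth-setting pairs `(i, k)` and the
literal occurrences `(j, s)`. -/
def matchingTriple {n m : ℕ} (φ : Fin m → Fin 3 → Lit n) {mocc : Fin n → ℕ}
    (hpos : ∀ i, 0 < mocc i) (e : ∀ i, Fin (mocc i) ≃ Occ φ i) (σ : Fin n → Bool)
    (slot : Fin m → Fin 3 ≃ Fin 3) :
    (Σ i, Fin (mocc i)) ⊕ (Fin m × Fin 3) → Wt mocc × Xt mocc m × Yt mocc m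
  | .inl p => bif σ p.1 then trueTriple mocc m p.1 p.2 else falseTriple hpos m p.1 p.2
  | .inr q => garbTriple φ e q.1 q.2 (!(σ (φ q.1 q.2).1)) (slot q.1 q.2)

section

variable {n m : ℕ} (φ : Fin m → Fin 3 → Lit n) {mocc : Fin n → ℕ}
  (hpos : ∀ i, 0 < mocc i) (e : ∀ i, Fin (mocc i) ≃ Occ φ i) (σ : Fin n → Bool)
  (slot : Fin m → Fin 3 ≃ Fin 3)

theorem matchingTriple_fst_bijective :
    Function.Bijective fun x => (matchingTriple φ hpos e σ slot x).1 := by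
  have hl : ∀ p, (matchingTriple φ hpos e σ slot (.inl p)).1 = (p, σ p.1) := by
    intro p
    cases h : σ p.1 <;> simp [matchingTriple, h, trueTriple, falseTriple]
  have hr : ∀ q, (matchingTriple φ hpos e σ slot (.inr q)).1 =
      (⟨(φ q.1 q.2).1, occIdx φ e q.1 q.2⟩, !σ (φ q.1 q.2).1) := fun _ => rfl
  have hocc := occNode_bijective φ e
  constructor
  · rintro (p | q) (p' | q') h
    · simp only [hl, Prod.mk.injEq] at h
      rw [h.1]
    · simp only [hl, hr, Prod.mk.injEq] at h
      obtain ⟨rfl, h⟩ := h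
      simp at h
    · simp only [hl, hr, Prod.mk.injEq] at h
      obtain ⟨rfl, h⟩ := h
      simp at h
    · exact congrArg Sum.inr (hocc.1 (congrArg Prod.fst h))
  · rintro ⟨p, b⟩
    by_cases hb : σ p.1 = b
    · exact ⟨.inl p, by simp [hl, hb]⟩
    · obtain ⟨q, rfl⟩ := hocc.2 p
      refine ⟨.inr q, ?_⟩
      simpa [hr, Bool.eq_not] using hb

theorem clauseSlot_bijective :
    Function.Bijective fun q : Fin m × Fin 3 => (q.1, slot q.1 q.2) :=
  (Equiv.prodShear (Equiv.refl _) slot).bijective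

theorem matchingTriple_snd_fst_bijective :
    Function.Bijective fun x => (matchingTriple φ hpos e σ slot x).2.1 := by
  have hp : Function.Bijective fun p : Σ i, Fin (mocc i) =>
      (⟨p.1, bif σ p.1 then p.2 else nextIdx hpos p.2⟩ : Σ i, Fin (mocc i)) := by
    have hfib : ∀ i, Function.Bijective fun k : Fin (mocc i) =>
        bif σ i then k else nextIdx hpos k := by
      intro i
      cases σ i
      · exact nextIdx_bijective hpos i
      · exact Function.bijective_id
    constructor
    · rintro ⟨i, k⟩ ⟨i', k'⟩ h
      obtain rfl : i = i' := congrArg Sigma.fst h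
      exact congrArg (Sigma.mk i) ((hfib i).1 (eq_of_heq (Sigma.mk.inj h).2))
    · rintro ⟨i, k⟩
      obtain ⟨l, hl⟩ := (hfib i).2 k
      exact ⟨⟨i, l⟩, congrArg (Sigma.mk i) hl⟩
  convert hp.sumMap (clauseSlot_bijective slot) using 1
  funext x
  rcases x with p | q
  · cases h : σ p.1 <;> simp [matchingTriple, h, trueTriple, falseTriple]
  · rfl

theorem matchingTriple_snd_snd_bijective :
    Function.Bijective fun x => (matchingTriple φ hpos e σ slot x).2.2 := by
  convert Function.bijective_id.sumMap (clauseSlot_bijective slot) using 1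
  funext x
  rcases x with p | q
  · cases h : σ p.1 <;> simp [matchingTriple, h, trueTriple, falseTriple]
  · rfl

variable {φ} {σ} {slot}

theorem satTriple_eq_garbTriple {j : Fin m} {s : Fin 3} (hs : σ (φ j s).1 = (φ j s).2)
    (h0 : slot j s = 0) :
    satTriple φ e j s = garbTriple φ e j s (!(σ (φ j s).1)) (slot j s) := by
  simp [satTriple, garbTriple, hs, h0]

theorem range_matchingTriple {pick : Fin m → Fin 3}
    (hpick : ∀ j, σ (φ j (pick j)).1 = (φ j (pick j)).2)
    (hslot : ∀ j, slot j (pick j) = 0) :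
    Set.range (matchingTriple φ hpos e σ slot) =
      {t | ∃ i, ∃ k, σ i = true ∧ t = trueTriple mocc m i k}
        ∪ {t | ∃ i, ∃ k, σ i = false ∧ t = falseTriple hpos m i k}
        ∪ {t | ∃ j, t = satTriple φ e j (pick j)}
        ∪ {t | ∃ j, ∃ s, s ≠ pick j ∧
            t = garbTriple φ e j s (!(σ (φ j s).1)) (slot j s)} := by
  have hsat := fun j => satTriple_eq_garbTriple e (hpick j) (hslot j)
  apply Set.Subset.antisymm
  · rintro _ ⟨⟨i, k⟩ | ⟨j, s⟩, rfl⟩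
    · cases h : σ i
      · exact .inl (.inl (.inr ⟨i, k, h, by simp [matchingTriple, h]⟩))
      · exact .inl (.inl (.inl ⟨i, k, h, by simp [matchingTriple, h]⟩))
    · by_cases hs : s = pick j
      · subst hs
        exact .inl (.inr ⟨j, (hsat j).symm⟩)
      · exact .inr ⟨j, s, hs, rfl⟩
  · rintro _ (((⟨i, k, h, rfl⟩ | ⟨i, k, h, rfl⟩) | ⟨j, rfl⟩) | ⟨j, s, -, rfl⟩)
    · exact ⟨.inl ⟨i, k⟩, by simp [matchingTriple, h]⟩
    · exact ⟨.inl ⟨i, k⟩, by simp [matchingTriple, h]⟩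
    · exact ⟨.inr (j, pick j), (hsat j).symm⟩
    · exact ⟨.inr (j, s), rfl⟩

theorem matchingTriple_mem_matches {pick : Fin m → Fin 3}
    (hpick : ∀ j, σ (φ j (pick j)).1 = (φ j (pick j)).2)
    (hslot : ∀ j, slot j (pick j) = 0) (x : (Σ i, Fin (mocc i)) ⊕ (Fin m × Fin 3)) :
    matchingTriple φ hpos e σ slot x ∈ Matches φ mocc hpos e := by
  have hx := Set.mem_range_self (f := matchingTriple φ hpos e σ slot) x
  rw [range_matchingTriple hpos e hpick hslot] at hx
  rcases hx with ((⟨i, k, -, h⟩ | ⟨i, k, -, h⟩) | ⟨j, h⟩) | ⟨j, s, hs, h⟩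
  · exact .inl (.inl (.inl ⟨i, k, h⟩))
  · exact .inl (.inl (.inr ⟨i, k, h⟩))
  · exact .inl (.inr ⟨j, pick j, h⟩)
  · exact .inr ⟨j, s, _, _, fun h0 => hs ((slot j).injective (h0.trans (hslot j).symm)), h⟩

end

/-- If `σ` satisfies `φ`, then the explicitly described set
`M'` is a perfect matching of the constructed 3DM instance.  Here `pick j` is
a chosen slot of clause `j` whose literal is made true by `σ`, and `slot j` is
a numbering of the slots of clause `j` sending the picked slot to `0 = t[j]`
and the other two slots bijectively to `{1, 2} = {tf_1[j], tf_2[j]}`.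
`M'` consists of: the truth-setting triples `(c_k[i], a_k[i], b_k[i])` for all
`k` when `σ x_i` is true, `(c'_k[i], a_{k+1}[i], b_k[i])` for all `k` when
`σ x_i` is false; for each clause the satisfaction triple of its picked true
literal; and for each clause garbage-collection triples covering
`tf_r[j], tf'_r[j]` using the remaining uncovered `c`/`c'` nodes (flag
`!(σ x_i)`) of the two unpicked literal occurrences. -/
theorem explicit_set_isPerfectMatching
    {n m : ℕ} (φ : Fin m → Fin 3 → Lit n) (mocc : Fin n → ℕ)
    (hpos : ∀ i, 0 < mocc i) (e : ∀ i, Fin (mocc i) ≃ Occ φ i)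
    (σ : Fin n → Bool) (hσ : Satisfies φ σ)
    (pick : Fin m → Fin 3)
    (hpick : ∀ j, σ (φ j (pick j)).1 = (φ j (pick j)).2)
    (slot : Fin m → Fin 3 ≃ Fin 3)
    (hslot : ∀ j, slot j (pick j) = 0) :
    IsPerfectMatching (Matches φ mocc hpos e)
      ({t | ∃ i, ∃ k, σ i = true ∧ t = trueTriple mocc m i k}
        ∪ {t | ∃ i, ∃ k, σ i = false ∧ t = falseTriple hpos m i k}
        ∪ {t | ∃ j, t = satTriple φ e j (pick j)}
        ∪ {t | ∃ j, ∃ s, s ≠ pick j ∧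
            t = garbTriple φ e j s (!(σ (φ j s).1)) (slot j s)}) := by
  rw [← range_matchingTriple hpos e hpick hslot]
  exact isPerfectMatching_range (matchingTriple_mem_matches hpos e hpick hslot)
    (matchingTriple_fst_bijective φ hpos e σ slot)
    (matchingTriple_snd_fst_bijective φ hpos e σ slot)
    (matchingTriple_snd_snd_bijective φ hpos e σ slot)
end

section
/- In every perfect matching M' of the constructed 3DM instance, for every variable x_i the set of truth-setting triples of x_i contained in M' is either exactly {(c_k[i], a_k[i], b_k[i]) : 1 ≤ k ≤ m_i} or exactly {(c'_k[i], a_{k+1}[i], b_k[i]) : 1 ≤ k ≤ m_i}; that is, each variable gadget is resolved consistently as true or consistently as false. -/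
variable {n m : ℕ}

/-- A predicate on the indices of a gadget which is preserved by the cyclic successor and holds
somewhere holds everywhere. -/
theorem forall_of_nextIdx {n : ℕ} {mocc : Fin n → ℕ} (hpos : ∀ i, 0 < mocc i) {i : Fin n}
    {P : Fin (mocc i) → Prop} (hP : ∀ k, P k → P (nextIdx hpos k)) {k : Fin (mocc i)}
    (hk : P k) (l : Fin (mocc i)) : P l := by
  have iter : ∀ t : ℕ, P ⟨(k.1 + t) % mocc i, Nat.mod_lt _ (hpos i)⟩ := by
    intro t
    induction t with
    | zero => simpa [Nat.mod_eq_of_lt k.2] using hk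
    | succ t ih => simpa [nextIdx, Nat.mod_add_mod, add_assoc] using hP _ ih
  have hl := iter (mocc i - k.1 + l.1)
  have hsum : k.1 + (mocc i - k.1 + l.1) = mocc i + l.1 := by omega
  simpa [hsum, Nat.mod_eq_of_lt l.2] using hl

/-- Every `b_k[i]` is covered by one of the two truth-setting triples containing it. -/
theorem trueTriple_mem_or_falseTriple_mem {n m : ℕ} {φ : Fin m → Fin 3 → Lit n}
    {mocc : Fin n → ℕ} {hpos : ∀ i, 0 < mocc i} {e : ∀ i, Fin (mocc i) ≃ Occ φ i}
    {M' : Set (Wt mocc × Xt mocc m × Yt mocc m)}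
    (hM' : IsPerfectMatching (Matches φ mocc hpos e) M') (i : Fin n) (k : Fin (mocc i)) :
    trueTriple mocc m i k ∈ M' ∨ falseTriple hpos m i k ∈ M' := by
  obtain ⟨t, ⟨ht, hb⟩, -⟩ := hM'.2.2.2 (Sum.inl ⟨i, k⟩)
  rcases hM'.1 ht with ((⟨i', k', rfl⟩ | ⟨i', k', rfl⟩) | ⟨j, s, rfl⟩) | ⟨j, s, b, r, -, rfl⟩
  · cases Sum.inl_injective hb
    exact Or.inl ht
  · cases Sum.inl_injective hb
    exact Or.inr ht
  · cases hb
  · cases hb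

theorem trueTriple_ne_falseTriple {n m : ℕ} {mocc : Fin n → ℕ} (hpos : ∀ i, 0 < mocc i)
    (i : Fin n) (k l : Fin (mocc i)) : trueTriple mocc m i k ≠ falseTriple hpos m i l :=
  fun h => Bool.noConfusion (congrArg (fun t => t.1.2) h)

/-- In every perfect matching `M'` of the constructed 3DM
instance, for each variable `x_i` the set of truth-setting triples of `x_i`
contained in `M'` is either exactly `{(c_k[i], a_k[i], b_k[i]) : k}` or exactly
`{(c'_k[i], a_{k+1}[i], b_k[i]) : k}`: each variable gadget is resolved
consistently as true or consistently as false. -/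
theorem gadget_consistent
    {n m : ℕ} (φ : Fin m → Fin 3 → Lit n) (mocc : Fin n → ℕ)
    (hpos : ∀ i, 0 < mocc i) (e : ∀ i, Fin (mocc i) ≃ Occ φ i)
    (M' : Set (Wt mocc × Xt mocc m × Yt mocc m))
    (hM' : IsPerfectMatching (Matches φ mocc hpos e) M')
    (i : Fin n) :
    {t ∈ M' | (∃ k, t = trueTriple mocc m i k) ∨ (∃ k, t = falseTriple hpos m i k)}
        = {t | ∃ k, t = trueTriple mocc m i k} ∨
      {t ∈ M' | (∃ k, t = trueTriple mocc m i k) ∨ (∃ k, t = falseTriple hpos m i k)}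
        = {t | ∃ k, t = falseTriple hpos m i k} := by
  have not_both : ∀ k, trueTriple mocc m i k ∈ M' → falseTriple hpos m i k ∉ M' := fun k hT hF =>
    trueTriple_ne_falseTriple hpos i k k
      ((hM'.2.2.2 (Sum.inl ⟨i, k⟩)).unique ⟨hT, rfl⟩ ⟨hF, rfl⟩)
  have step : ∀ k, falseTriple hpos m i k ∈ M' → falseTriple hpos m i (nextIdx hpos k) ∈ M' :=
    fun k hF => (trueTriple_mem_or_falseTriple_mem hM' i (nextIdx hpos k)).resolve_left fun hT =>
      trueTriple_ne_falseTriple hpos i (nextIdx hpos k) k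
        ((hM'.2.2.1 (Sum.inl ⟨i, nextIdx hpos k⟩)).unique ⟨hT, rfl⟩ ⟨hF, rfl⟩)
  by_cases h : ∃ k, falseTriple hpos m i k ∈ M'
  · obtain ⟨k, hk⟩ := h
    have hF : ∀ l, falseTriple hpos m i l ∈ M' := forall_of_nextIdx hpos step hk
    right
    ext t
    constructor
    · rintro ⟨ht, ⟨l, rfl⟩ | hl⟩
      · exact absurd (hF l) (not_both l ht)
      · exact hl
    · rintro ⟨l, rfl⟩
      exact ⟨hF l, Or.inr ⟨l, rfl⟩⟩
  · left
    ext t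
    constructor
    · rintro ⟨ht, hl | ⟨l, rfl⟩⟩
      · exact hl
      · exact absurd ⟨l, ht⟩ h
    · rintro ⟨l, rfl⟩
      exact ⟨(trueTriple_mem_or_falseTriple_mem hM' i l).resolve_right fun hF => h ⟨l, hF⟩,
        Or.inl ⟨l, rfl⟩⟩
end

section
/- Let M' be any perfect matching of the constructed 3DM instance, and define the truth assignment σ by σ(x_i) = true if and only if the truth-setting triple (c_1[i], a_1[i], b_1[i]) belongs to M'. Then σ satisfies every clause of φ; in particular, for each clause C_j, the unique triple of M' containing t[j] is the satisfaction triple of a literal of C_j that is made true by σ. -/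
variable {n m : ℕ}

/-- Taking successors modulo `mocc i` is injective. -/
theorem nextIdx_injective {n : ℕ} {mocc : Fin n → ℕ} (hpos : ∀ i, 0 < mocc i) {i : Fin n} :
    Function.Injective (nextIdx hpos : Fin (mocc i) → Fin (mocc i)) := by
  intro k l h
  have h' : (k.1 + 1) % mocc i = (l.1 + 1) % mocc i := congrArg Fin.val h
  have h'' : k.1 ≡ l.1 [MOD mocc i] := Nat.ModEq.add_right_cancel' 1 h'
  exact Fin.ext (h''.eq_of_lt_of_lt k.2 l.2)

section

variable {n m : ℕ} {φ : Fin m → Fin 3 → Lit n} {mocc : Fin n → ℕ}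
  {hpos : ∀ i, 0 < mocc i} {e : ∀ i, Fin (mocc i) ≃ Occ φ i}
  {M' : Set (Wt mocc × Xt mocc m × Yt mocc m)}

/-- Covering `b_k[i]` exactly once means choosing exactly one truth-setting triple at `k`. -/
theorem trueTriple_mem_iff_falseTriple_notMem
    (hM' : IsPerfectMatching (Matches φ mocc hpos e) M') (i : Fin n) (k : Fin (mocc i)) :
    trueTriple mocc m i k ∈ M' ↔ falseTriple hpos m i k ∉ M' := by
  obtain ⟨hsub, -, -, hY⟩ := hM'
  obtain ⟨t, ⟨ht, hty⟩, -⟩ := hY (Sum.inl ⟨i, k⟩)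
  constructor
  · intro hT hF
    have := (hY (Sum.inl ⟨i, k⟩)).unique ⟨hT, rfl⟩ ⟨hF, rfl⟩
    simp [trueTriple, falseTriple] at this
  · intro hF
    rcases hsub ht with ((⟨i', k', rfl⟩ | ⟨i', k', rfl⟩) | ⟨j, s, rfl⟩) | ⟨j, s, b, r, -, rfl⟩
    · cases hty
      exact ht
    · cases hty
      exact absurd ht hF
    · cases hty
    · cases hty

/-- Covering `a_{k+1}[i]` exactly once means choosing exactly one of the two truth-setting triples
that contain it. -/
theorem trueTriple_nextIdx_mem_iff_falseTriple_notMem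
    (hM' : IsPerfectMatching (Matches φ mocc hpos e) M') (i : Fin n) (k : Fin (mocc i)) :
    trueTriple mocc m i (nextIdx hpos k) ∈ M' ↔ falseTriple hpos m i k ∉ M' := by
  obtain ⟨hsub, -, hX, -⟩ := hM'
  obtain ⟨t, ⟨ht, htx⟩, -⟩ := hX (Sum.inl ⟨i, nextIdx hpos k⟩)
  constructor
  · intro hT hF
    have := (hX (Sum.inl ⟨i, nextIdx hpos k⟩)).unique ⟨hT, rfl⟩ ⟨hF, rfl⟩
    simp [trueTriple, falseTriple] at this
  · intro hF
    rcases hsub ht with ((⟨i', k', rfl⟩ | ⟨i', k', rfl⟩) | ⟨j, s, rfl⟩) | ⟨j, s, b, r, -, rfl⟩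
    · simp only [trueTriple, Sum.inl.injEq] at htx
      cases htx
      exact ht
    · simp only [falseTriple, Sum.inl.injEq, Sigma.mk.injEq] at htx
      obtain ⟨rfl, h⟩ := htx
      cases nextIdx_injective hpos (eq_of_heq h)
      exact absurd ht hF
    · cases htx
    · cases htx

/-- A perfect matching makes the same choice at every index of a truth-setting gadget. -/
theorem trueTriple_mem_iff_zero
    (hM' : IsPerfectMatching (Matches φ mocc hpos e) M') (i : Fin n) (k : Fin (mocc i)) :
    trueTriple mocc m i k ∈ M' ↔ trueTriple mocc m i ⟨0, hpos i⟩ ∈ M' := by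
  obtain ⟨k, hk⟩ := k
  induction k with
  | zero => rfl
  | succ k ih =>
    have hk' : k < mocc i := Nat.lt_of_succ_lt hk
    have hnext : nextIdx hpos ⟨k, hk'⟩ = ⟨k + 1, hk⟩ := Fin.ext (Nat.mod_eq_of_lt hk)
    rw [← ih hk', ← hnext, trueTriple_nextIdx_mem_iff_falseTriple_notMem hM',
      trueTriple_mem_iff_falseTriple_notMem hM']

end

/-- Let `M'` be any perfect matching of the constructed 3DM
instance and define `σ` by `σ x_i = true` iff the truth-setting triple
`(c_1[i], a_1[i], b_1[i])` (first occurrence index, i.e. `k = 0` here) belongs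
to `M'`.  Then `σ` satisfies every clause of `φ`; in particular, for each
clause `C_j` the unique triple of `M'` containing `t[j]` is the satisfaction
triple of a literal of `C_j` made true by `σ`. -/
theorem assignment_from_matching_satisfies
    {n m : ℕ} (φ : Fin m → Fin 3 → Lit n) (mocc : Fin n → ℕ)
    (hpos : ∀ i, 0 < mocc i) (e : ∀ i, Fin (mocc i) ≃ Occ φ i)
    (M' : Set (Wt mocc × Xt mocc m × Yt mocc m))
    (hM' : IsPerfectMatching (Matches φ mocc hpos e) M')
    (σ : Fin n → Bool)
    (hσ : ∀ i : Fin n, σ i = true ↔ trueTriple mocc m i ⟨0, hpos i⟩ ∈ M') :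
    Satisfies φ σ ∧
      ∀ j : Fin m, ∀ t ∈ M', t.2.1 = Sum.inr (j, 0) →
        ∃ s : Fin 3, σ (φ j s).1 = (φ j s).2 ∧ t = satTriple φ e j s := by
  have key : ∀ j : Fin m, ∀ t ∈ M', t.2.1 = Sum.inr (j, 0) →
      ∃ s : Fin 3, σ (φ j s).1 = (φ j s).2 ∧ t = satTriple φ e j s := by
    intro j t ht htx
    rcases hM'.1 ht with ((⟨i, k, rfl⟩ | ⟨i, k, rfl⟩) | ⟨j', s, rfl⟩) | ⟨j', s, b, r, hr, rfl⟩
    · cases htx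
    · cases htx
    · cases htx
      refine ⟨s, ?_, rfl⟩
      have hσk := (hσ (φ j s).1).trans (trueTriple_mem_iff_zero hM' _ (occIdx φ e j s)).symm
      have hW := hM'.2.1 (⟨(φ j s).1, occIdx φ e j s⟩, !(φ j s).2)
      cases hp : (φ j s).2 with
      | true =>
        rw [hσk, trueTriple_mem_iff_falseTriple_notMem hM']
        intro hF
        have := hW.unique ⟨ht, rfl⟩ ⟨hF, by simp [falseTriple, hp]⟩
        simp [satTriple, falseTriple] at this
      | false =>
        rw [← Bool.not_eq_true, hσk]
        intro hT
        have := hW.unique ⟨ht, rfl⟩ ⟨hT, by simp [trueTriple, hp]⟩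
        simp [satTriple, trueTriple] at this
    · simp only [garbTriple, Sum.inr.injEq, Prod.mk.injEq] at htx
      exact absurd htx.2 hr
  refine ⟨fun j => ?_, key⟩
  obtain ⟨t, ⟨ht, htx⟩, -⟩ := hM'.2.2.1 (Sum.inr (j, 0))
  obtain ⟨s, hs, -⟩ := key j t ht htx
  exact ⟨s, hs⟩
end
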